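/- Let A be the unital ℂ-algebra of 2×2 matrices (a b; c d) over 𝕄 = ℂ[t,t⁻¹] with a, d balanced and b, c anti-balanced. For c anti-balanced, let c' denote the unique balanced Laurent polynomial with c = (t − t⁻¹)·c'. Then the map Ψ : A → M₂(𝕃) × ℂ × ℂ sending (a b; c d) to the triple consisting of the matrix (a, (t−t⁻¹)b; c', d), the value d(1), and the value d(−1), is an injective homomorphism of unital ℂ-algebras. -/

import Mathlib

open LaurentPolynomial

/-- The subalgebra `𝕃` of balanced Laurent polynomials, i.e. those fixed by
the involution `α = LaurentPolynomial.invert` (determined by `t ↦ t⁻¹`). -/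
noncomputable def balSub : Subalgebra ℂ (LaurentPolynomial ℂ) :=
  AlgHom.equalizer (invert (R := ℂ)).toAlgHom (AlgHom.id ℂ (LaurentPolynomial ℂ))

/-- The unital `ℂ`-algebra `A` of `2×2` matrices over `𝕄 = ℂ[t,t⁻¹]` whose
diagonal entries are balanced and whose off-diagonal entries are
anti-balanced. -/
noncomputable def matSub : Subalgebra ℂ (Matrix (Fin 2) (Fin 2) (LaurentPolynomial ℂ)) where
  carrier := {M | invert (M 0 0) = M 0 0 ∧ invert (M 1 1) = M 1 1 ∧
    invert (M 0 1) = -(M 0 1) ∧ invert (M 1 0) = -(M 1 0)}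
  one_mem' := by
    simp [Matrix.one_apply]
  add_mem' := by
    rintro M N ⟨h1, h2, h3, h4⟩ ⟨g1, g2, g3, g4⟩
    refine ⟨?_, ?_, ?_, ?_⟩ <;>
      simp [Matrix.add_apply, map_add, h1, h2, h3, h4, g1, g2, g3, g4] <;> ring
  mul_mem' := by
    rintro M N ⟨h1, h2, h3, h4⟩ ⟨g1, g2, g3, g4⟩
    refine ⟨?_, ?_, ?_, ?_⟩ <;>
      simp [Matrix.mul_apply, Fin.sum_univ_two, map_add, map_mul,
        h1, h2, h3, h4, g1, g2, g3, g4] <;> ring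
  algebraMap_mem' := by
    intro r
    refine ⟨?_, ?_, ?_, ?_⟩ <;> simp [Matrix.algebraMap_matrix_apply]

theorem T_one_sub_T_neg_one_ne_zero : (T 1 - T (-1) : LaurentPolynomial ℂ) ≠ 0 := fun h =>
  absurd (AddMonoidAlgebra.single_left_injective one_ne_zero (sub_eq_zero.mp h)) (by decide)

theorem T_one_sub_T_neg_one_dvd_T_sub_T_neg (n : ℤ) :
    (T 1 - T (-1) : LaurentPolynomial ℂ) ∣ T n - T (-n) := by
  have key (m : ℕ) : (T 1 - T (-1) : LaurentPolynomial ℂ) ∣ T m - T (-m) := by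
    simpa [T_pow] using sub_dvd_pow_sub_pow (T 1 : LaurentPolynomial ℂ) (T (-1)) m
  obtain ⟨m, rfl | rfl⟩ := n.eq_nat_or_neg
  · exact key m
  · rw [neg_neg, ← dvd_neg, neg_sub]
    exact key m

theorem T_one_sub_T_neg_one_dvd_sub_invert (p : LaurentPolynomial ℂ) :
    (T 1 - T (-1) : LaurentPolynomial ℂ) ∣ p - invert p := by
  induction p using LaurentPolynomial.induction_on' with
  | add p q hp hq =>
    rw [map_add, add_sub_add_comm]
    exact dvd_add hp hq
  | C_mul_T n a =>
    rw [map_mul, invert_C, invert_T, ← mul_sub]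
    exact (T_one_sub_T_neg_one_dvd_T_sub_T_neg n).mul_left _

theorem T_one_sub_T_neg_one_dvd_of_invert_eq_neg {p : LaurentPolynomial ℂ}
    (hp : invert p = -p) : (T 1 - T (-1) : LaurentPolynomial ℂ) ∣ p := by
  have h := (T_one_sub_T_neg_one_dvd_sub_invert p).mul_left (C (1 / 2 : ℂ))
  have h2 : (C (1 / 2 : ℂ) : LaurentPolynomial ℂ) * 2 = 1 := by
    rw [← map_ofNat (C (R := ℂ)) 2, ← map_mul]
    norm_num
  rwa [hp, sub_neg_eq_add, ← two_mul, ← mul_assoc, h2, one_mul] at h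

theorem mem_balSub_iff {p : LaurentPolynomial ℂ} : p ∈ balSub ↔ invert p = p := Iff.rfl

theorem exists_balSub_mul_eq {p : LaurentPolynomial ℂ} (hp : invert p = -p) :
    ∃ q : balSub, (T 1 - T (-1)) * (q : LaurentPolynomial ℂ) = p := by
  obtain ⟨q, rfl⟩ := T_one_sub_T_neg_one_dvd_of_invert_eq_neg hp
  refine ⟨⟨q, mem_balSub_iff.mpr (mul_left_cancel₀ T_one_sub_T_neg_one_ne_zero ?_)⟩, rfl⟩
  simp only [map_mul, map_sub, invert_T, neg_neg] at hp
  linear_combination -hp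

theorem T_one_sub_T_neg_one_mul_mem_balSub {p : LaurentPolynomial ℂ} (hp : invert p = -p) :
    (T 1 - T (-1)) * p ∈ balSub := by
  simp only [mem_balSub_iff, map_mul, map_sub, invert_T, neg_neg, hp]
  ring

/-- The balanced Laurent polynomial `c'` with `c = (t - t⁻¹) * c'`, where `c` is the lower left
entry of `M`. -/
noncomputable def lowerLeftQuotient (M : matSub) : balSub :=
  (exists_balSub_mul_eq M.2.2.2.2).choose

theorem mul_lowerLeftQuotient (M : matSub) :
    (T 1 - T (-1)) * (lowerLeftQuotient M : LaurentPolynomial ℂ) = M.1 1 0 :=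
  (exists_balSub_mul_eq M.2.2.2.2).choose_spec

theorem lowerLeftQuotient_eq {M : matSub} {q : balSub}
    (h : (T 1 - T (-1)) * (q : LaurentPolynomial ℂ) = M.1 1 0) : lowerLeftQuotient M = q :=
  Subtype.ext <| mul_left_cancel₀ T_one_sub_T_neg_one_ne_zero <|
    (mul_lowerLeftQuotient M).trans h.symm

/-- Conjugation of a matrix in `matSub` by `diag(t - t⁻¹, 1)`, as a balanced matrix. -/
noncomputable def conjBalanced : matSub →ₐ[ℂ] Matrix (Fin 2) (Fin 2) balSub :=
  AlgHom.ofLinearMap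
    { toFun := fun M =>
        !![⟨M.1 0 0, M.2.1⟩, ⟨(T 1 - T (-1)) * M.1 0 1,
            T_one_sub_T_neg_one_mul_mem_balSub M.2.2.2.1⟩;
          lowerLeftQuotient M, ⟨M.1 1 1, M.2.2.1⟩]
      map_add' := fun M N => by
        have h : lowerLeftQuotient (M + N) = lowerLeftQuotient M + lowerLeftQuotient N :=
          lowerLeftQuotient_eq (by simp [mul_add, mul_lowerLeftQuotient])
        ext i j : 2
        fin_cases i <;> fin_cases j <;> simp [h, mul_add]
      map_smul' := fun r M => by
        have h : lowerLeftQuotient (r • M) = r • lowerLeftQuotient M :=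
          lowerLeftQuotient_eq (by simp [mul_lowerLeftQuotient])
        ext i j : 2
        fin_cases i <;> fin_cases j <;> simp [h] }
    (by
      have h : lowerLeftQuotient 1 = 0 := lowerLeftQuotient_eq (by simp)
      ext i j : 2
      fin_cases i <;> fin_cases j <;> simp [h])
    (fun M N => by
      have hM := mul_lowerLeftQuotient M
      have hN := mul_lowerLeftQuotient N
      have h : lowerLeftQuotient (M * N) = lowerLeftQuotient M * ⟨N.1 0 0, N.2.1⟩ +
          ⟨M.1 1 1, M.2.2.1⟩ * lowerLeftQuotient N :=
        lowerLeftQuotient_eq (by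
          simp only [MulMemClass.coe_mul, AddMemClass.coe_add, Matrix.mul_apply,
            Fin.sum_univ_two, ← hM, ← hN]
          ring)
      ext i j : 2
      fin_cases i <;> fin_cases j <;>
        simp [h, Matrix.mul_apply, Fin.sum_univ_two, ← hM, ← hN] <;> ring)

/-- Evaluation of the lower right entry at a point where `t - t⁻¹` vanishes. -/
noncomputable def evalLowerRight (ev : LaurentPolynomial ℂ →ₐ[ℂ] ℂ)
    (h : ev (T 1 - T (-1)) = 0) : matSub →ₐ[ℂ] ℂ :=
  AlgHom.ofLinearMap
    { toFun := fun M => ev (M.1 1 1)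
      map_add' := fun M N => by simp
      map_smul' := fun r M => by simp }
    (by simp)
    (fun M N => by
      simp [Matrix.mul_apply, Fin.sum_univ_two, ← mul_lowerLeftQuotient M, -map_sub, h])

/-- Let `A` be the unital `ℂ`-algebra of `2×2` matrices
`(a b; c d)` over `𝕄 = ℂ[t,t⁻¹]` with `a, d` balanced and `b, c`
anti-balanced.  The map `Ψ : A → M₂(𝕃) × ℂ × ℂ`,
`(a b; c d) ↦ ((a, (t−t⁻¹)b; c', d), d(1), d(−1))` — where `c'` is the unique
balanced Laurent polynomial with `c = (t−t⁻¹)·c'` and `d(±1)` denotes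
evaluation at `t = ±1` — is an injective homomorphism of unital
`ℂ`-algebras.  (The evaluation maps at `1` and `−1` are specified as the
`ℂ`-algebra homomorphisms `ev1`, `evneg1` with `ev1 (tⁿ) = 1` and
`evneg1 (tⁿ) = (−1)ⁿ`.) -/
theorem stmt6 (ev1 evneg1 : LaurentPolynomial ℂ →ₐ[ℂ] ℂ)
    (hev1 : ∀ n : ℤ, ev1 (T n) = 1)
    (hevneg1 : ∀ n : ℤ, evneg1 (T n) = (-1 : ℂ) ^ n) :
    ∃ Ψ : ↥matSub →ₐ[ℂ] (Matrix (Fin 2) (Fin 2) ↥balSub × ℂ × ℂ),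
      Function.Injective Ψ ∧
      ∀ (M : Matrix (Fin 2) (Fin 2) (LaurentPolynomial ℂ)) (hM : M ∈ matSub),
        (((Ψ ⟨M, hM⟩).1 0 0 : LaurentPolynomial ℂ) = M 0 0) ∧
        (((Ψ ⟨M, hM⟩).1 0 1 : LaurentPolynomial ℂ) = (T 1 - T (-1)) * M 0 1) ∧
        ((T 1 - T (-1)) * ((Ψ ⟨M, hM⟩).1 1 0 : LaurentPolynomial ℂ) = M 1 0) ∧
        (((Ψ ⟨M, hM⟩).1 1 1 : LaurentPolynomial ℂ) = M 1 1) ∧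
        ((Ψ ⟨M, hM⟩).2.1 = ev1 (M 1 1)) ∧
        ((Ψ ⟨M, hM⟩).2.2 = evneg1 (M 1 1)) := by
  have h1 : ev1 (T 1 - T (-1)) = 0 := by simp [hev1]
  have h2 : evneg1 (T 1 - T (-1)) = 0 := by simp [hevneg1]
  refine ⟨conjBalanced.prod ((evalLowerRight ev1 h1).prod (evalLowerRight evneg1 h2)),
    fun M N hMN => ?_, fun M hM => ⟨rfl, rfl, mul_lowerLeftQuotient ⟨M, hM⟩, rfl, rfl, rfl⟩⟩
  have h (i j : Fin 2) : conjBalanced M i j = conjBalanced N i j :=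
    congrFun (congrFun (congrArg Prod.fst hMN) i) j
  ext i j : 2
  fin_cases i <;> fin_cases j
  · exact congrArg Subtype.val (h 0 0)
  · exact mul_left_cancel₀ T_one_sub_T_neg_one_ne_zero (congrArg Subtype.val (h 0 1))
  · have h10 : lowerLeftQuotient M = lowerLeftQuotient N := h 1 0
    exact (mul_lowerLeftQuotient M).symm.trans (h10 ▸ mul_lowerLeftQuotient N)
  · exact congrArg Subtype.val (h 1 1)
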